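/- For every finite nonempty set Δ ⊂ ℕ with min Δ = gcd Δ, there exists a finitely generated reduced Krull monoid H such that Δ(H) = Δ. -/

import Mathlib

/-- Set of lengths of factorizations of `a` into irreducible elements (atoms). -/
def LengthsOf {M : Type*} [CommMonoid M] (a : M) : Set ℕ :=
  {n | ∃ s : Multiset M, Multiset.card s = n ∧ (∀ x ∈ s, Irreducible x) ∧ s.prod = a}

/-- The set of distances (delta set) of a monoid. -/
def DeltaSet (M : Type*) [CommMonoid M] : Set ℕ :=
  {d | 0 < d ∧ ∃ (a : M) (k : ℕ), k ∈ LengthsOf a ∧ k + d ∈ LengthsOf a ∧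
      ∀ ℓ ∈ LengthsOf a, ¬(k < ℓ ∧ ℓ < k + d)}

/-- A monoid is atomic if every nonunit is a finite product of irreducible elements. -/
def IsAtomicMonoid (M : Type*) [CommMonoid M] : Prop :=
  ∀ a : M, ¬ IsUnit a → ∃ s : Multiset M, (∀ x ∈ s, Irreducible x) ∧ s.prod = a

universe u

/-- A monoid is Krull if it admits a divisor homomorphism into a free abelian monoid. -/
def IsKrullMonoid (M : Type u) [CommMonoid M] : Prop :=
  ∃ (P : Type u) (φ : M →* Multiplicative (P →₀ ℕ)), ∀ a b : M, a ∣ b ↔ φ a ∣ φ b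

/-- The monoid of zero-sum sequences over `G₀ ⊆ G`, as a submonoid of the
free abelian monoid (written multiplicatively) of multisets over `G`. -/
def ZeroSumMonoid {G : Type*} [AddCommGroup G] (G₀ : Set G) :
    Submonoid (Multiplicative (Multiset G)) where
  carrier := {S | (∀ x ∈ Multiplicative.toAdd S, x ∈ G₀) ∧ (Multiplicative.toAdd S).sum = 0}
  one_mem' := by simp
  mul_mem' := by
    intro a b ha hb
    refine ⟨?_, ?_⟩
    · intro x hx
      rw [toAdd_mul, Multiset.mem_add] at hx
      exact hx.elim (ha.1 x) (hb.1 x)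
    · rw [toAdd_mul, Multiset.sum_add, ha.2, hb.2, add_zero]

namespace RD

set_option linter.unusedSectionVars false

section Mon
variable {ι : Type} [Fintype ι] [DecidableEq ι] (p : ι → ℕ)

abbrev Z := ∀ i, Fin (p i) → ℕ

def Phi : Z p →+ ((∀ i, Fin (p i)) → ℕ) where
  toFun z g := ∑ i, z i (g i)
  map_zero' := by funext g; simp
  map_add' a b := by funext g; simp [Finset.sum_add_distrib]

abbrev Mo := Multiplicative (AddMonoidHom.mrange (Phi p))

def cancelMo : CancelCommMonoid (Mo p) :=
  { (inferInstance : CommMonoid (Mo p)) with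
    mul_left_cancel := by
      intro a b c h
      apply Multiplicative.toAdd.injective
      apply Subtype.ext
      have h1 : (Multiplicative.toAdd a).1 + (Multiplicative.toAdd b).1
        = (Multiplicative.toAdd a).1 + (Multiplicative.toAdd c).1 :=
          congrArg (fun x => (Multiplicative.toAdd x).1) h
      exact add_left_cancel h1 }

def pr (z : Z p) : Mo p := Multiplicative.ofAdd ((Phi p).mrangeRestrict z)

def len (z : Z p) : ℕ := ∑ i, ∑ j, z i j

def ev (i : ι) (j : Fin (p i)) : Z p := Pi.single i (Pi.single j 1)

variable {p}

lemma pr_add (a b : Z p) : pr p (a + b) = pr p a * pr p b := by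
  simp [pr, ofAdd_add]

lemma pr_zero : pr p 0 = 1 := by
  simp [pr]

lemma pr_eq {a b : Z p} : pr p a = pr p b ↔ ∀ g : (∀ i, Fin (p i)), ∑ i, a i (g i) = ∑ i, b i (g i) := by
  unfold pr
  rw [Multiplicative.ofAdd.injective.eq_iff, Subtype.ext_iff]
  exact funext_iff

lemma pr_surj (m : Mo p) : ∃ z, pr p z = m := by
  obtain ⟨z, hz⟩ := (Phi p).mrangeRestrict_surjective (Multiplicative.toAdd m)
  exact ⟨z, by unfold pr; rw [hz]; rfl⟩

lemma len_add (a b : Z p) : len p (a + b) = len p a + len p b := by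
  simp [len, Finset.sum_add_distrib]

lemma len_zero : len p 0 = 0 := by simp [len]

lemma ev_apply (i : ι) (j : Fin (p i)) (k : ι) (l : Fin (p k)) :
    ev p i j k l = if (⟨i, j⟩ : Σ i, Fin (p i)) = ⟨k, l⟩ then 1 else 0 := by
  unfold ev
  by_cases h : i = k
  · subst h
    simp [Pi.single_apply, eq_comm]
  · have : k ≠ i := fun e => h e.symm
    simp [Pi.single_apply, this, h]

lemma len_ev (i : ι) (j : Fin (p i)) : len p (ev p i j) = 1 := by
  unfold len ev
  rw [Finset.sum_eq_single i]
  · simp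
  · intro b _ hb; simp [hb]
  · simp

lemma decomp {z : Z p} (hz : z ≠ 0) : ∃ i j z', z = ev p i j + z' := by
  have : ∃ i j, z i j ≠ 0 := by
    by_contra! h
    exact hz (by funext i j; exact h i j)
  obtain ⟨i, j, h⟩ := this
  refine ⟨i, j, z - ev p i j, ?_⟩
  funext k l
  simp only [Pi.add_apply, Pi.sub_apply, ev_apply]
  split_ifs with e
  · cases e; omega
  · omega

lemma len_eq_zero {z : Z p} (h : len p z = 0) : z = 0 := by
  by_contra hz
  obtain ⟨i, j, z', rfl⟩ := decomp hz
  rw [len_add, len_ev] at h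
  omega

lemma Zind {C : Z p → Prop} (h0 : C 0) (h1 : ∀ i j z, C z → C (ev p i j + z)) : ∀ z, C z := by
  intro z
  induction hn : len p z generalizing z with
  | zero => rw [len_eq_zero hn]; exact h0
  | succ n ih =>
    have hz : z ≠ 0 := by rintro rfl; rw [len_zero] at hn; omega
    obtain ⟨i, j, z', rfl⟩ := decomp hz
    apply h1
    apply ih
    rw [len_add, len_ev] at hn
    omega

variable (hp : ∀ i, 2 ≤ p i)
include hp

/-- kernel description -/
lemma pr_eq_iff {a b : Z p} : pr p a = pr p b ↔
    ∃ x : ι → ℤ, (∑ i, x i = 0) ∧ ∀ i j, (b i j : ℤ) = a i j + x i := by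
  rw [pr_eq]
  constructor
  · intro h
    let g0 : ∀ i, Fin (p i) := fun i => ⟨0, by have := hp i; omega⟩
    have hrow : ∀ i j, (b i j : ℤ) - a i j = b i (g0 i) - a i (g0 i) := by
      intro i j
      have h1 := h g0
      have h2 := h (Function.update g0 i j)
      rw [← Finset.add_sum_erase _ _ (Finset.mem_univ i),
        ← Finset.add_sum_erase _ _ (Finset.mem_univ i)] at h1 h2
      have e : ∀ c : Z p, ∑ k ∈ Finset.univ.erase i, c k (Function.update g0 i j k)
          = ∑ k ∈ Finset.univ.erase i, c k (g0 k) := by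
        intro c
        apply Finset.sum_congr rfl
        intro k hk
        rw [Function.update_of_ne (Finset.ne_of_mem_erase hk)]
      rw [e, e, Function.update_self] at h2
      omega
    refine ⟨fun i => b i (g0 i) - a i (g0 i), ?_, fun i j => by have := hrow i j; dsimp only; omega⟩
    have h1 := h g0
    rw [Finset.sum_sub_distrib]
    have : (∑ i, (a i (g0 i) : ℤ)) = ∑ i, (b i (g0 i) : ℤ) := by exact_mod_cast h1
    omega
  · rintro ⟨x, hx, h⟩ g
    have : (∑ i, (b i (g i) : ℤ)) = ∑ i, (a i (g i) : ℤ) := by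
      simp only [h, Finset.sum_add_distrib, hx, add_zero]
    exact_mod_cast this.symm

lemma pr_ev_eq {i : ι} {j : Fin (p i)} {b : Z p} (h : pr p b = pr p (ev p i j)) :
    b = ev p i j := by
  obtain ⟨x, hx, h⟩ := (pr_eq_iff hp).1 h
  have h0 : ∀ k, ∃ l, ev p i j k l = 0 := by
    intro k
    have := hp k
    have h2 : ∃ l : Fin (p k), (⟨i, j⟩ : Σ i, Fin (p i)) ≠ ⟨k, l⟩ := by
      by_cases e : i = k
      · subst e
        have : Nontrivial (Fin (p i)) := Fin.nontrivial_iff_two_le.2 this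
        obtain ⟨l, hl⟩ := exists_ne j
        exact ⟨l, fun e => hl (by cases e; rfl)⟩
      · exact ⟨⟨0, by omega⟩, fun e' => e (by cases e'; rfl)⟩
    obtain ⟨l, hl⟩ := h2
    exact ⟨l, by rw [ev_apply, if_neg hl]⟩
  have hle : ∀ k, x k ≤ 0 := by
    intro k
    obtain ⟨l, hl⟩ := h0 k
    have := h k l
    rw [hl] at this
    push_cast at this
    omega
  have hz : ∀ k, x k = 0 := by
    intro k
    exact (Finset.sum_eq_zero_iff_of_nonpos (fun k _ => hle k)).1 hx k (Finset.mem_univ k)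
  funext k l
  have := h k l
  rw [hz] at this
  omega

lemma pr_eq_one {b : Z p} (h : pr p b = 1) : b = 0 := by
  rw [← pr_zero] at h
  obtain ⟨x, hx, h⟩ := (pr_eq_iff hp).1 h
  have hle : ∀ k, x k ≤ 0 := by
    intro k
    have := h k ⟨0, by have := hp k; omega⟩
    simp only [Pi.zero_apply] at this
    push_cast at this
    omega
  have hz : ∀ k, x k = 0 := by
    intro k
    exact (Finset.sum_eq_zero_iff_of_nonpos (fun k _ => hle k)).1 hx k (Finset.mem_univ k)
  funext k l
  have := h k l
  rw [hz] at this
  simp only [Pi.zero_apply] at this ⊢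
  omega

lemma reduced (u : Mo p) (hu : IsUnit u) : u = 1 := by
  obtain ⟨v, hv⟩ := isUnit_iff_exists_inv.1 hu
  obtain ⟨a, rfl⟩ := pr_surj u
  obtain ⟨b, rfl⟩ := pr_surj v
  rw [← pr_add] at hv
  have := pr_eq_one hp hv
  have ha : a = 0 := by
    funext i j
    have := congrFun (congrFun this i) j
    simp only [Pi.add_apply, Pi.zero_apply] at this ⊢
    omega
  rw [ha, pr_zero]

lemma irr_ev (i : ι) (j : Fin (p i)) : Irreducible (pr p (ev p i j)) := by
  constructor
  · intro h
    have := pr_eq_one hp (reduced hp _ h)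
    have := congrArg (len p) this
    rw [len_ev, len_zero] at this
    omega
  · intro u v h
    obtain ⟨a, rfl⟩ := pr_surj u
    obtain ⟨b, rfl⟩ := pr_surj v
    rw [← pr_add] at h
    have h1 := pr_ev_eq hp h.symm
    have := congrArg (len p) h1
    rw [len_add, len_ev] at this
    rcases (by omega : len p a = 0 ∨ len p b = 0) with h | h
    · left; rw [len_eq_zero h, pr_zero]; exact isUnit_one
    · right; rw [len_eq_zero h, pr_zero]; exact isUnit_one

lemma irr_iff {m : Mo p} (hm : Irreducible m) : ∃ i j, m = pr p (ev p i j) := by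
  obtain ⟨z, rfl⟩ := pr_surj m
  have hz : z ≠ 0 := by
    rintro rfl
    exact hm.not_isUnit (by rw [pr_zero]; exact isUnit_one)
  obtain ⟨i, j, z', rfl⟩ := decomp hz
  refine ⟨i, j, ?_⟩
  rw [pr_add] at hm ⊢
  rcases hm.isUnit_or_isUnit rfl with h | h
  · exact absurd h (irr_ev hp i j).not_isUnit
  · rw [reduced hp _ h, mul_one]

lemma lengths (m : Mo p) : LengthsOf m = {n | ∃ z, pr p z = m ∧ len p z = n} := by
  ext n
  constructor
  · rintro ⟨s, rfl, hs, rfl⟩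
    induction s using Multiset.induction with
    | empty => exact ⟨0, by simp [pr_zero], by simp [len_zero]⟩
    | cons a s ih =>
      obtain ⟨z, hz, hl⟩ := ih (fun x hx => hs x (Multiset.mem_cons_of_mem hx))
      obtain ⟨i, j, e⟩ := irr_iff hp (hs a (Multiset.mem_cons_self a s))
      refine ⟨ev p i j + z, ?_, ?_⟩
      · rw [pr_add, hz, Multiset.prod_cons, e]
      · rw [len_add, len_ev, hl, Multiset.card_cons]; omega
  · rintro ⟨z, rfl, rfl⟩
    induction z using Zind with
    | h0 => exact ⟨0, by simp [len_zero], by simp, by simp [pr_zero]⟩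
    | h1 i j z ih =>
      obtain ⟨s, h1, h2, h3⟩ := ih
      refine ⟨pr p (ev p i j) ::ₘ s, ?_, ?_, ?_⟩
      · rw [Multiset.card_cons, h1, len_add, len_ev]; omega
      · intro x hx
        rcases Multiset.mem_cons.1 hx with rfl | hx
        · exact irr_ev hp i j
        · exact h2 x hx
      · rw [Multiset.prod_cons, h3, pr_add]

omit hp in
lemma fg : ∃ S : Finset (Mo p), Submonoid.closure (S : Set (Mo p)) = ⊤ := by
  classical
  refine ⟨Finset.univ.image (fun a : Σ i, Fin (p i) => pr p (ev p a.1 a.2)), ?_⟩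
  rw [eq_top_iff]
  rintro m -
  obtain ⟨z, rfl⟩ := pr_surj m
  induction z using Zind with
  | h0 => rw [pr_zero]; exact one_mem _
  | h1 i j z ih =>
    rw [pr_add]
    refine mul_mem (Submonoid.subset_closure ?_) ih
    simp only [Finset.coe_image, Finset.coe_univ, Set.image_univ]
    exact ⟨⟨i, j⟩, rfl⟩

lemma krull_aux [Nonempty ι] {a b : Z p}
    (h : ∀ g : (∀ i, Fin (p i)), ∑ i, a i (g i) ≤ ∑ i, b i (g i)) :
    ∃ c, pr p b = pr p a * pr p c := by
  have hmin : ∀ i, ∃ j : Fin (p i), ∀ l, (b i j : ℤ) - a i j ≤ b i l - a i l := by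
    intro i
    have : Nonempty (Fin (p i)) := ⟨⟨0, by have := hp i; omega⟩⟩
    exact Finite.exists_min (fun j => (b i j : ℤ) - a i j)
  choose g hg using hmin
  have hs : 0 ≤ ∑ i, ((b i (g i) : ℤ) - a i (g i)) := by
    rw [Finset.sum_sub_distrib]
    have := h g
    have : (∑ i, (a i (g i) : ℤ)) ≤ ∑ i, (b i (g i) : ℤ) := by exact_mod_cast this
    omega
  set S := ∑ i, ((b i (g i) : ℤ) - a i (g i)) with hS
  obtain ⟨i0⟩ := ‹Nonempty ι›
  let x : ι → ℤ := fun i => ((b i (g i) : ℤ) - a i (g i)) - (if i = i0 then S else 0)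
  have hx : ∑ i, x i = 0 := by
    simp only [x, Finset.sum_sub_distrib (f := fun i => ((b i (g i) : ℤ) - a i (g i))), ← hS]
    simp
  have hxle : ∀ i l, x i ≤ b i l - a i l := by
    intro i l
    have := hg i l
    simp only [x]
    split_ifs <;> omega
  refine ⟨fun i l => ((b i l : ℤ) - a i l - x i).toNat, ?_⟩
  rw [← pr_add, eq_comm, pr_eq_iff hp]
  refine ⟨x, hx, fun i j => ?_⟩
  have := hxle i j
  simp only [Pi.add_apply]
  push_cast
  rw [Int.toNat_of_nonneg (by omega)]
  ring

lemma krull [Nonempty ι] : IsKrullMonoid (Mo p) := by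
  classical
  let φ : (AddMonoidHom.mrange (Phi p)) →+ ((∀ i, Fin (p i)) →₀ ℕ) :=
    ((Finsupp.linearEquivFunOnFinite ℕ ℕ (∀ i, Fin (p i))).symm.toLinearMap.toAddMonoidHom).comp
      (AddSubmonoid.subtype _)
  refine ⟨(∀ i, Fin (p i)), AddMonoidHom.toMultiplicative φ, fun u v => ⟨fun h => map_dvd _ h, ?_⟩⟩
  intro h
  obtain ⟨a, rfl⟩ := pr_surj u
  obtain ⟨b, rfl⟩ := pr_surj v
  obtain ⟨c, hc⟩ := h
  have key : ∀ g : (∀ i, Fin (p i)), ∑ i, a i (g i) ≤ ∑ i, b i (g i) := by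
    intro g
    have h2 := DFunLike.congr_fun (congrArg Multiplicative.toAdd hc) g
    have e : ∀ z : Z p, (Multiplicative.toAdd ((AddMonoidHom.toMultiplicative φ) (pr p z))) g
        = ∑ i, z i (g i) := fun z => rfl
    rw [toAdd_mul, Finsupp.add_apply, e, e] at h2
    omega
  obtain ⟨c, hc⟩ := krull_aux hp key
  exact ⟨_, hc⟩

omit hp in
/-- the n-fold sumset -/
def W (p : ι → ℕ) (n : ℕ) : Set ℕ := {s | ∃ y : ι → ℕ, ∑ i, y i = n ∧ ∑ i, p i * y i = s}

lemma lengths' (m : Mo p) : ∃ r n, LengthsOf m = (fun s => r + s) '' W p n := by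
  obtain ⟨z, rfl⟩ := pr_surj m
  have hmin : ∀ i, ∃ j : Fin (p i), ∀ l, z i j ≤ z i l := by
    intro i
    have : Nonempty (Fin (p i)) := ⟨⟨0, by have := hp i; omega⟩⟩
    exact Finite.exists_min (fun j => z i j)
  choose g hg using hmin
  have hle : ∑ i, p i * z i (g i) ≤ len p z := by
    unfold len
    apply Finset.sum_le_sum
    intro i _
    have := Finset.sum_le_sum (s := Finset.univ) (fun l _ => hg i l)
    simpa using this
  refine ⟨len p z - ∑ i, p i * z i (g i), ∑ i, z i (g i), ?_⟩
  rw [lengths hp]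
  have hlen : ∀ (z' : Z p) (x : ι → ℤ), (∀ i j, (z' i j : ℤ) = z i j + x i) →
      (len p z' : ℤ) = len p z + ∑ i, p i * x i := by
    intro z' x h
    unfold len
    push_cast
    simp only [h, Finset.sum_add_distrib]
    simp
  ext n
  constructor
  · rintro ⟨z', hz', rfl⟩
    obtain ⟨x, hx, h⟩ := (pr_eq_iff hp).1 hz'.symm
    have hl := hlen z' x h
    refine ⟨∑ i, p i * z' i (g i), ⟨fun i => z' i (g i), ?_, rfl⟩, ?_⟩
    · zify
      simp only [h, Finset.sum_add_distrib, hx, add_zero]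
    · zify [hle]
      simp only [h, mul_add, Finset.sum_add_distrib]
      rw [hl]; ring
  · rintro ⟨s, ⟨y, hy, rfl⟩, rfl⟩
    have h : ∀ i j, (((z i j - z i (g i) + y i : ℕ)) : ℤ) = z i j + ((y i : ℤ) - z i (g i)) := by
      intro i j
      have := hg i j
      omega
    refine ⟨fun i j => z i j - z i (g i) + y i, ?_, ?_⟩
    · rw [eq_comm, pr_eq_iff hp]
      refine ⟨fun i => (y i : ℤ) - z i (g i), ?_, h⟩
      rw [Finset.sum_sub_distrib]
      have : (∑ i, (y i : ℤ)) = ∑ i, (z i (g i) : ℤ) := by exact_mod_cast hy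
      omega
    · have := hlen (fun i j => z i j - z i (g i) + y i) (fun i => (y i : ℤ) - z i (g i)) h
      zify [hle]
      rw [this]
      simp only [mul_sub, Finset.sum_sub_distrib]
      ring

/-- an element whose set of lengths is exactly the set of the `p i` -/
lemma lengths_one [Nonempty ι] : ∃ m : Mo p, LengthsOf m = W p 1 := by
  obtain ⟨i0⟩ := ‹Nonempty ι›
  let z : Z p := Pi.single i0 (fun _ => 1)
  refine ⟨pr p z, ?_⟩
  rw [lengths hp]
  have hz0 : ∀ i (j l : Fin (p i)), z i j = z i l := by
    intro i j l
    by_cases h : i = i0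
    · subst h; simp [z]
    · simp [z, h]
  have hz1 : ∀ g : (∀ i, Fin (p i)), ∑ i, z i (g i) = 1 := by
    intro g
    rw [Finset.sum_eq_single i0]
    · simp [z]
    · intro b _ hb; simp [z, hb]
    · simp
  let g0 : ∀ i, Fin (p i) := fun i => ⟨0, by have := hp i; omega⟩
  ext n
  constructor
  · rintro ⟨z', hz', rfl⟩
    have h1 := pr_eq.1 hz' g0
    obtain ⟨x, hx, h⟩ := (pr_eq_iff hp).1 hz'.symm
    refine ⟨fun i => z' i (g0 i), h1.trans (hz1 g0), ?_⟩
    unfold len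
    apply Finset.sum_congr rfl
    intro i _
    have : ∀ j, z' i j = z' i (g0 i) := by
      intro j
      have a1 := h i j
      have a2 := h i (g0 i)
      rw [hz0 i j (g0 i)] at a1
      omega
    simp [this]
  · rintro ⟨y, hy, rfl⟩
    refine ⟨fun i _ => y i, ?_, ?_⟩
    · rw [pr_eq]
      intro g
      rw [hz1, hy]
    · simp [len]

end Mon

section Comb

def InQ (Δ : Finset ℕ) (d m x : ℕ) : Prop :=
  x ≤ 2 * m * (m + 1) ∧ d ∣ x ∧ ∀ e ∈ Δ, ¬(2 * m * e < x ∧ x < 2 * m * e + e)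

variable {Δ : Finset ℕ} {d m : ℕ}

structure Hyp (Δ : Finset ℕ) (d m : ℕ) : Prop where
  dmem : d ∈ Δ
  mmem : m ∈ Δ
  pos : ∀ e ∈ Δ, 0 < e
  dvd : ∀ e ∈ Δ, d ∣ e
  le : ∀ e ∈ Δ, e ≤ m

variable (H : Hyp Δ d m)
include H

lemma mulle {e : ℕ} (he : e ∈ Δ) : 2 * m * e + 2 * m ≤ 2 * m * (m + 1) := by
  have := Nat.mul_le_mul_left (2 * m) (Nat.succ_le_succ (H.le e he))
  rw [Nat.succ_eq_add_one, mul_add, mul_one] at this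
  exact this

lemma sep {e f r : ℕ} (he : e ∈ Δ) (hf : f ∈ Δ) (hr : r ≤ e)
    (h0 : r = 0 ∨ r = e) : ¬(2 * m * f < 2 * m * e + r ∧ 2 * m * e + r < 2 * m * f + f) := by
  rintro ⟨h1, h2⟩
  have := H.le e he
  have := H.le f hf
  have := H.pos e he
  have := H.pos f hf
  rcases lt_trichotomy e f with h | h | h
  · have := Nat.mul_le_mul_left (2 * m) (Nat.succ_le_of_lt h)
    rw [Nat.succ_eq_add_one, mul_add, mul_one] at this
    omega
  · subst h; omega
  · have := Nat.mul_le_mul_left (2 * m) (Nat.succ_le_of_lt h)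
    rw [Nat.succ_eq_add_one, mul_add, mul_one] at this
    omega

lemma inQ_left {e : ℕ} (he : e ∈ Δ) : InQ Δ d m (2 * m * e) := by
  refine ⟨?_, Dvd.dvd.mul_left (H.dvd e he) _, fun f hf => ?_⟩
  · have := mulle H he; omega
  · simpa using sep H he hf (Nat.zero_le e) (Or.inl rfl)

lemma inQ_right {e : ℕ} (he : e ∈ Δ) : InQ Δ d m (2 * m * e + e) := by
  refine ⟨?_, Dvd.dvd.add (Dvd.dvd.mul_left (H.dvd e he) _) (H.dvd e he), fun f hf => ?_⟩
  · have := mulle H he; have := H.le e he; omega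
  · exact sep H he hf le_rfl (Or.inr rfl)

lemma inQ_low {x : ℕ} (hd : d ∣ x) (hx : x ≤ m) : InQ Δ d m x := by
  refine ⟨?_, hd, fun f hf => ?_⟩
  · have := mulle H H.mmem; omega
  · have := H.pos f hf
    have := Nat.le_mul_of_pos_right (2 * m) this
    omega

lemma dvdT : d ∣ 2 * m * (m + 1) :=
  Dvd.dvd.mul_right (Dvd.dvd.mul_left (H.dvd m H.mmem) _) _

lemma inQ_high {x : ℕ} (hd : d ∣ x) (hx : x ≤ m) : InQ Δ d m (2 * m * (m + 1) - x) := by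
  refine ⟨by omega, Nat.dvd_sub (dvdT H) hd, fun f hf => ?_⟩
  have := mulle H hf
  have := H.le f hf
  omega

lemma hole {x : ℕ} (hx : x ≤ 2 * m * (m + 1)) (hd : d ∣ x) (h : ¬ InQ Δ d m x) :
    ∃ e ∈ Δ, 2 * m * e < x ∧ x < 2 * m * e + e := by
  by_contra hc
  push Not at hc
  exact h ⟨hx, hd, fun e he => by have := hc e he; omega⟩

/-- consecutive elements -/
lemma gapQ {x y : ℕ} (hx : InQ Δ d m x) (hy : InQ Δ d m y) (hxy : x < y)
    (hg : ∀ z, InQ Δ d m z → ¬ (x < z ∧ z < y)) : y - x ∈ Δ := by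
  have hd0 := H.pos d H.dmem
  have hle : x + d ≤ y := by
    have := Nat.le_of_dvd (by omega) (Nat.dvd_sub hy.2.1 hx.2.1)
    omega
  by_cases h : InQ Δ d m (x + d)
  · have := hg _ h
    have : y - x = d := by omega
    rw [this]; exact H.dmem
  · obtain ⟨e, he, h1, h2⟩ := hole H (hle.trans hy.1) (Dvd.dvd.add hx.2.1 dvd_rfl) h
    have h3 := hx.2.2 e he
    have hdD : d ∣ 2 * m * e := Dvd.dvd.mul_left (H.dvd e he) _
    have h4 : x = 2 * m * e := by
      by_contra hne
      have := Nat.le_of_dvd (by omega) (Nat.dvd_sub hdD hx.2.1)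
      omega
    have h5 := hg _ (inQ_right H he)
    have h6 := hy.2.2 e he
    have : y - x = e := by omega
    rw [this]; exact he

lemma two {x : ℕ} (hx : x ≤ 2 * (2 * m * (m + 1))) (hd : d ∣ x) :
    ∃ a b, InQ Δ d m a ∧ InQ Δ d m b ∧ a + b = x := by
  by_cases h : x ≤ 2 * m * (m + 1)
  · by_cases hq : InQ Δ d m x
    · exact ⟨x, 0, hq, inQ_low H (dvd_zero d) (Nat.zero_le _), rfl⟩
    · obtain ⟨e, he, h1, h2⟩ := hole H h hd hq
      have := H.le e he
      exact ⟨2 * m * e, x - 2 * m * e, inQ_left H he,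
        inQ_low H (Nat.dvd_sub hd (Dvd.dvd.mul_left (H.dvd e he) _)) (by omega), by omega⟩
  · have hd' : d ∣ x - 2 * m * (m + 1) := Nat.dvd_sub hd (dvdT H)
    by_cases hq : InQ Δ d m (x - 2 * m * (m + 1))
    · exact ⟨_, _, hq, inQ_high H (dvd_zero d) (Nat.zero_le _), by omega⟩
    · obtain ⟨e, he, h1, h2⟩ := hole H (by omega) hd' hq
      have := H.le e he
      have := mulle H he
      exact ⟨2 * m * e + e, 2 * m * (m + 1) - (2 * m * e + e - (x - 2 * m * (m + 1))),
        inQ_right H he,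
        inQ_high H (Nat.dvd_sub (inQ_right H he).2.1 hd') (by omega), by omega⟩

end Comb

section Fin
open Classical in
noncomputable def Qf (Δ : Finset ℕ) (d m : ℕ) : Finset ℕ :=
  (Finset.range (2 * m * (m + 1) + 1)).filter (InQ Δ d m)

lemma mem_Qf {Δ : Finset ℕ} {d m x : ℕ} : x ∈ Qf Δ d m ↔ InQ Δ d m x := by
  classical
  unfold Qf
  simp only [Finset.mem_filter, Finset.mem_range]
  exact ⟨fun h => h.2, fun h => ⟨by have := h.1; omega, h⟩⟩

def pp (Δ : Finset ℕ) (d m : ℕ) (i : Qf Δ d m) : ℕ := 2 + i.1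

variable {Δ : Finset ℕ} {d m : ℕ}

lemma W_one (s : ℕ) : s ∈ W (pp Δ d m) 1 ↔ ∃ x, InQ Δ d m x ∧ s = 2 + x := by
  constructor
  · rintro ⟨y, hy, rfl⟩
    have : ∃ i, y i ≠ 0 := by
      by_contra! h
      simp [h] at hy
    obtain ⟨i, hi⟩ := this
    rw [← Finset.add_sum_erase _ _ (Finset.mem_univ i)] at hy
    have h0 : ∑ k ∈ Finset.univ.erase i, y k = 0 := by omega
    have h1 : y i = 1 := by omega
    rw [Finset.sum_eq_zero_iff] at h0
    refine ⟨i.1, mem_Qf.1 i.2, ?_⟩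
    rw [← Finset.add_sum_erase _ _ (Finset.mem_univ i), h1, Finset.sum_eq_zero]
    · simp [pp]
    · intro k hk; rw [h0 k hk, mul_zero]
  · rintro ⟨x, hx, rfl⟩
    refine ⟨Pi.single ⟨x, mem_Qf.2 hx⟩ 1, by simp, ?_⟩
    rw [Finset.sum_eq_single ⟨x, mem_Qf.2 hx⟩]
    · simp [pp]
    · intro b _ hb; simp [hb]
    · simp

lemma W_add {a b n k : ℕ} (ha : a ∈ W (pp Δ d m) n) (hb : b ∈ W (pp Δ d m) k) :
    a + b ∈ W (pp Δ d m) (n + k) := by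
  obtain ⟨y, rfl, rfl⟩ := ha
  obtain ⟨y', rfl, rfl⟩ := hb
  exact ⟨y + y', by simp [Finset.sum_add_distrib], by simp [mul_add, Finset.sum_add_distrib]⟩

lemma W_sub {s n : ℕ} (hs : s ∈ W (pp Δ d m) n) :
    ∃ x, s = 2 * n + x ∧ d ∣ x ∧ x ≤ n * (2 * m * (m + 1)) := by
  obtain ⟨y, rfl, rfl⟩ := hs
  refine ⟨∑ i, i.1 * y i, ?_, ?_, ?_⟩
  · simp [pp, add_mul, Finset.sum_add_distrib, Finset.mul_sum]
  · exact Finset.dvd_sum fun i _ => Dvd.dvd.mul_right (mem_Qf.1 i.2).2.1 _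
  · rw [Finset.sum_mul]
    refine Finset.sum_le_sum fun i _ => ?_
    rw [mul_comm]
    exact Nat.mul_le_mul_left _ (mem_Qf.1 i.2).1

lemma W_full (H : Hyp Δ d m) (n : ℕ) : ∀ x, d ∣ x → x ≤ (n + 2) * (2 * m * (m + 1)) →
    2 * (n + 2) + x ∈ W (pp Δ d m) (n + 2) := by
  induction n with
  | zero =>
    intro x hd hx
    obtain ⟨a, b, ha, hb, rfl⟩ := two H (x := x) (by simpa using hx) hd
    have := W_add ((W_one _).2 ⟨a, ha, rfl⟩) ((W_one _).2 ⟨b, hb, rfl⟩)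
    convert this using 1
    omega
  | succ n ih =>
    intro x hd hx
    by_cases h : x ≤ (n + 2) * (2 * m * (m + 1))
    · have := W_add (ih x hd h) ((W_one _).2 ⟨0, inQ_low H (dvd_zero d) (Nat.zero_le _), rfl⟩)
      convert this using 1
      omega
    · have hT : 2 * m * (m + 1) ≤ (n + 2) * (2 * m * (m + 1)) :=
        Nat.le_mul_of_pos_left _ (by omega)
      have e : (n + 1 + 2) * (2 * m * (m + 1)) = (n + 2) * (2 * m * (m + 1)) + 2 * m * (m + 1) := by
        ring
      have := W_add (ih (x - 2 * m * (m + 1)) (Nat.dvd_sub hd (dvdT H)) (by omega))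
        ((W_one _).2 ⟨_, inQ_high H (dvd_zero d) (Nat.zero_le _), rfl⟩)
      convert this using 1
      omega

lemma W_gap (H : Hyp Δ d m) {n k e : ℕ} (he : 0 < e) (hk : k ∈ W (pp Δ d m) n)
    (hke : k + e ∈ W (pp Δ d m) n) (hg : ∀ l ∈ W (pp Δ d m) n, ¬(k < l ∧ l < k + e)) : e ∈ Δ := by
  match n with
  | 0 =>
    obtain ⟨x, h1, _, h2⟩ := W_sub hk
    obtain ⟨x', h1', _, h2'⟩ := W_sub hke
    omega
  | 1 =>
    obtain ⟨x, hx, rfl⟩ := (W_one _).1 hk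
    obtain ⟨y, hy, h⟩ := (W_one _).1 hke
    have := gapQ H hx hy (by omega) (fun z hz => by
      have := hg _ ((W_one _).2 ⟨z, hz, rfl⟩)
      omega)
    have e' : y - x = e := by omega
    rwa [e'] at this
  | n + 2 =>
    obtain ⟨x, h1, h2, h3⟩ := W_sub hk
    obtain ⟨x', h1', h2', h3'⟩ := W_sub hke
    have hle := Nat.le_of_dvd (by omega) (Nat.dvd_sub h2' h2)
    have hd0 := H.pos d H.dmem
    have := hg _ (W_full H n (x + d) (Dvd.dvd.add h2 dvd_rfl) (by omega))
    have : e = d := by omega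
    rw [this]; exact H.dmem

end Fin

end RD

/-- Realization theorem: every finite nonempty set `Δ` of positive integers with
`min Δ = gcd Δ` is the set of distances of a finitely generated reduced Krull monoid. -/
theorem realization_deltaSet (Δ : Finset ℕ) (hne : Δ.Nonempty) (hpos : ∀ d ∈ Δ, 0 < d)
    (hgcd : Δ.min' hne = Δ.gcd id) :
    ∃ (M : Type) (_ : CancelCommMonoid M),
      IsKrullMonoid M ∧
      (∃ S : Finset M, Submonoid.closure (S : Set M) = ⊤) ∧
      (∀ u : M, IsUnit u → u = 1) ∧
      DeltaSet M = ↑Δ := by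
  have H : RD.Hyp Δ (Δ.min' hne) (Δ.max' hne) :=
    ⟨Δ.min'_mem hne, Δ.max'_mem hne, hpos, fun e he => by rw [hgcd]; exact Finset.gcd_dvd he,
      fun e he => Δ.le_max' e he⟩
  generalize Δ.min' hne = d at H
  generalize Δ.max' hne = m at H
  have hp : ∀ i, 2 ≤ RD.pp Δ d m i := fun i => Nat.le_add_right _ _
  have hne' : Nonempty (RD.Qf Δ d m) :=
    ⟨⟨0, RD.mem_Qf.2 (RD.inQ_low H (dvd_zero d) (Nat.zero_le _))⟩⟩
  suffices hD : DeltaSet (RD.Mo (RD.pp Δ d m)) = ↑Δ from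
    ⟨RD.Mo (RD.pp Δ d m), RD.cancelMo _, RD.krull hp, RD.fg, RD.reduced hp, hD⟩
  ext e
  constructor
  · rintro ⟨he, a, k, hk, hke, hg⟩
    obtain ⟨r, n, hL⟩ := RD.lengths' hp a
    have hL' : LengthsOf a = (fun s => r + s) '' RD.W (RD.pp Δ d m) n := hL
    rw [hL'] at hk hke hg
    obtain ⟨s, hs, rfl⟩ := hk
    obtain ⟨t, ht, h⟩ := hke
    dsimp only at h hg
    have ht' : t = s + e := by omega
    subst ht'
    refine RD.W_gap H he hs ht (fun l hl => ?_)
    have := hg _ ⟨l, hl, rfl⟩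
    dsimp only at this
    omega
  · intro he
    have he' : e ∈ Δ := he
    obtain ⟨a, hL⟩ := RD.lengths_one hp
    have hL' : LengthsOf a = RD.W (RD.pp Δ d m) 1 := hL
    refine ⟨hpos e he', a, 2 + 2 * m * e, ?_⟩
    rw [hL']
    refine ⟨(RD.W_one _).2 ⟨_, RD.inQ_left H he', rfl⟩,
      (RD.W_one _).2 ⟨_, RD.inQ_right H he', by omega⟩, ?_⟩
    intro l hl
    obtain ⟨x, hx, rfl⟩ := (RD.W_one _).1 hl
    have := hx.2.2 e he'
    omega
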